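/- Let b > 0 and let U be uniform on (0,1). For Re(s) > 1 define ζ_T(s;b) = ∑_{n=0}^∞ E[(-1)^n (n+b+U)^{-s}]. Let W have density h(w) = (2/π) log coth(π|w|/2) on ℝ. Then ζ_T(s;b) = (1/2) E[(b+iW)^{-s}] for Re(s) > 1, and ζ_T(·;b) extends to an entire function. -/

import Mathlib

open MeasureTheory Real

section

open Set Filter Topology

/-- The complex Gamma integral with a complex rate parameter: integrability. -/
lemma integrableOn_cpow_mul_exp_neg_mul {s a : ℂ} (hs : 0 < s.re) (ha : 0 < a.re) :
    IntegrableOn (fun t : ℝ => (t : ℂ) ^ (s - 1) * Complex.exp (-(a * t))) (Ioi 0) := by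
  have h := integrableOn_rpow_mul_exp_neg_mul_rpow (p := 1) (s := s.re - 1) (b := a.re)
    (by linarith) one_pos ha
  refine Integrable.mono' h ?_ ?_
  · refine ContinuousOn.aestronglyMeasurable (fun t ht => ContinuousAt.continuousWithinAt ?_)
      measurableSet_Ioi
    have : (t : ℂ) ∈ Complex.slitPlane := Or.inl (by simpa using ht)
    fun_prop (disch := assumption)
  · filter_upwards [ae_restrict_mem measurableSet_Ioi] with t ht
    rw [norm_mul, Complex.norm_cpow_eq_rpow_re_of_pos ht, Complex.norm_exp]
    simp

/-- The complex Gamma integral with a complex rate parameter. -/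
lemma integral_cpow_mul_exp_neg_complex_mul {s a : ℂ} (hs : 0 < s.re) (ha : 0 < a.re) :
    ∫ t in Ioi (0 : ℝ), (t : ℂ) ^ (s - 1) * Complex.exp (-(a * t)) =
      Complex.Gamma s * a ^ (-s) := by
  set U : Set ℂ := {z | 0 < z.re} with hU
  have hUo : IsOpen U := isOpen_lt continuous_const Complex.continuous_re
  have hUc : IsPreconnected U := (convex_halfSpace_re_gt 0).isPreconnected
  have hF : AnalyticOnNhd ℂ
      (fun a : ℂ => ∫ t in Ioi (0 : ℝ), (t : ℂ) ^ (s - 1) * Complex.exp (-(a * t))) U := by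
    refine DifferentiableOn.analyticOnNhd (fun z hz => ?_) hUo
    refine (DifferentiableAt.differentiableWithinAt ?_)
    have hz' : 0 < z.re := hz
    have hb := (integrableOn_cpow_mul_exp_neg_mul (s := s + 1) (a := (z.re / 2 : ℝ))
      (by simp; linarith) (by simpa using half_pos hz')).norm
    refine (hasDerivAt_integral_of_dominated_loc_of_deriv_le
      (s := {w : ℂ | z.re / 2 < w.re}) (x₀ := z)
      (F := fun (w : ℂ) (t : ℝ) => (t : ℂ) ^ (s - 1) * Complex.exp (-(w * t)))
      (F' := fun w t => (t : ℂ) ^ (s - 1) * (Complex.exp (-(w * t)) * (-t)))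
      ((isOpen_lt continuous_const Complex.continuous_re).mem_nhds
        (by simpa using half_lt_self hz')) ?_
      (integrableOn_cpow_mul_exp_neg_mul hs hz') ?_ ?_ hb ?_).2.differentiableAt
    · filter_upwards [hUo.mem_nhds hz] with w hw
      exact (integrableOn_cpow_mul_exp_neg_mul hs hw).aestronglyMeasurable
    · simp_rw [← mul_assoc]
      refine (integrableOn_cpow_mul_exp_neg_mul hs hz').aestronglyMeasurable.mul ?_
      exact Continuous.aestronglyMeasurable (by fun_prop)
    · filter_upwards [ae_restrict_mem measurableSet_Ioi] with t ht w hw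
      have ht' : 0 < t := ht
      have hw' : z.re / 2 < w.re := hw
      simp only [norm_mul, Complex.norm_cpow_eq_rpow_re_of_pos ht', Complex.norm_exp, norm_neg,
        Complex.norm_real, Real.norm_of_nonneg ht'.le]
      have : t ^ ((s + 1 - 1).re) = t ^ ((s - 1).re) * t := by
        rw [← Real.rpow_add_one ht'.ne']; simp
      rw [this, mul_assoc, mul_comm t]
      have hle : (-(w * t)).re ≤ (-(((z.re / 2 : ℝ) : ℂ) * t)).re := by
        simpa using mul_le_mul_of_nonneg_right hw'.le ht'.le
      gcongr
    · filter_upwards with t w _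
      have : HasDerivAt (fun w : ℂ => -(w * t)) (-(t : ℂ)) w := by
        simpa using! ((hasDerivAt_id w).mul_const (t : ℂ)).neg
      exact this.cexp.const_mul _
  have hG : AnalyticOnNhd ℂ (fun a : ℂ => Complex.Gamma s * a ^ (-s)) U := by
    refine DifferentiableOn.analyticOnNhd (fun z hz => ?_) hUo
    refine (DifferentiableAt.differentiableWithinAt ?_)
    have hz' : z ∈ Complex.slitPlane := Or.inl hz
    fun_prop (disch := assumption)
  refine hF.eqOn_of_preconnected_of_frequently_eq hG hUc (z₀ := 1) (by simp [hU]) ?_ ha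
  have hreal : ∀ r : ℝ, 0 < r →
      ∫ t in Ioi (0 : ℝ), (t : ℂ) ^ (s - 1) * Complex.exp (-((r : ℂ) * t)) =
        Complex.Gamma s * (r : ℂ) ^ (-s) := by
    intro r hr
    rw [Complex.integral_cpow_mul_exp_neg_mul_Ioi hs hr, mul_comm, one_div,
      Complex.inv_cpow _ _ (by rw [Complex.arg_ofReal_of_nonneg hr.le]; exact pi_pos.ne),
      Complex.cpow_neg]
  have ht : Tendsto (fun r : ℝ => (r : ℂ)) (𝓝[>] 1) (𝓝[≠] 1) := by
    refine tendsto_nhdsWithin_iff.2 ⟨?_, ?_⟩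
    · exact (Complex.continuous_ofReal.tendsto' 1 1 (by simp)).mono_left nhdsWithin_le_nhds
    · filter_upwards [self_mem_nhdsWithin] with r hr
      simpa using (ne_of_gt hr)
  refine ht.frequently (Eventually.frequently ?_)
  filter_upwards [self_mem_nhdsWithin] with r hr
  exact hreal r (zero_lt_one.trans hr)

lemma gamma_mul_integral_cpow {α : Type*} [MeasurableSpace α] {μ : Measure α} [SFinite μ]
    {g θ : α → ℂ} (hg : Integrable g μ) (hθ : Measurable θ) (hre : ∀ᵐ a ∂μ, 0 ≤ (θ a).re)
    {b : ℝ} (hb : 0 < b) {s : ℂ} (hs : 0 < s.re) :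
    Complex.Gamma s * ∫ a, (b + θ a) ^ (-s) * g a ∂μ =
      ∫ t in Ioi (0 : ℝ), (t : ℂ) ^ (s - 1) * Complex.exp (-(b * t)) *
        ∫ a, Complex.exp (-(θ a * t)) * g a ∂μ := by
  have h1 : Complex.Gamma s * ∫ a, (b + θ a) ^ (-s) * g a ∂μ =
      ∫ a, (∫ t in Ioi (0 : ℝ),
        (t : ℂ) ^ (s - 1) * Complex.exp (-(b * t)) * (Complex.exp (-(θ a * t)) * g a)) ∂μ := by
    rw [← integral_const_mul]
    refine integral_congr_ae ?_
    filter_upwards [hre] with a ha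
    rw [← mul_assoc, ← integral_cpow_mul_exp_neg_complex_mul hs
      (by simpa using add_pos_of_pos_of_nonneg hb ha), ← integral_mul_const]
    congr 1 with t
    rw [add_mul, neg_add, Complex.exp_add]
    ring
  rw [h1, integral_integral_swap]
  · simp_rw [integral_const_mul]
  · have hi := hg.mul_prod (integrableOn_cpow_mul_exp_neg_mul (a := b) hs (by simpa using hb))
    have := hi.bdd_mul (c := 1) (f := fun p : α × ℝ => Complex.exp (-(θ p.1 * p.2)))
      (by fun_prop) ?_
    · refine this.congr (Eventually.of_forall fun p => ?_)
      simp only [Function.uncurry]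
      ring
    · have e1 := (Measure.quasiMeasurePreserving_fst (μ := μ)
        (ν := volume.restrict (Ioi (0 : ℝ)))).ae hre
      have e2 := (Measure.quasiMeasurePreserving_snd (μ := μ)
        (ν := volume.restrict (Ioi (0 : ℝ)))).ae (ae_restrict_mem measurableSet_Ioi)
      filter_upwards [e1, e2] with p hp hp2
      rw [Complex.norm_exp]
      simpa using mul_nonneg hp (le_of_lt hp2)

lemma hasSum_inv_sq_add_odd_mul_pi_sq {t : ℝ} (ht : 0 < t) :
    HasSum (fun n : ℕ => 1 / (((2 * n + 1) * π : ℂ) ^ 2 + (t : ℂ) ^ 2))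
      ((1 - Complex.exp (-t)) / (1 + Complex.exp (-t)) / (4 * t)) := by
  have hπ : (π : ℂ) ≠ 0 := by exact_mod_cast pi_ne_zero
  have ht' : (t : ℂ) ≠ 0 := by exact_mod_cast ht.ne'
  have hcompl : ∀ x : ℝ, x ≠ 0 → (x : ℂ) * Complex.I ∈ Complex.integerComplement := by
    rintro x hx ⟨n, hn⟩
    exact hx (by simpa using (congrArg Complex.im hn).symm)
  obtain ⟨z, hz⟩ : ∃ z : ℂ, z = ((t / π : ℝ) : ℂ) * Complex.I := ⟨_, rfl⟩
  have hzc : z ∈ Complex.integerComplement := hz ▸ hcompl _ (by positivity)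
  have hzc2 : z / 2 ∈ Complex.integerComplement := by
    have := hcompl (t / π / 2) (by positivity)
    rw [hz]; convert this using 1; push_cast; ring
  have hz0 : z ≠ 0 := Complex.integerComplement.ne_zero hzc
  have hπz : π * z = t * Complex.I := by rw [hz]; push_cast; field_simp
  set f : ℕ → ℂ := fun n => 1 / (z - (n + 1)) + 1 / (z + (n + 1)) with hf
  have hfs : Summable f := summable_cotTerm hzc
  have h1 := cot_series_rep' hzc
  have h2 := cot_series_rep' hzc2
  have hodd : (∑' n : ℕ, (1 / (z / 2 - (n + 1)) + 1 / (z / 2 + (n + 1)))) =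
      2 * ∑' n : ℕ, f (2 * n + 1) := by
    rw [← tsum_mul_left]
    congr 1 with n
    have e1 : z / 2 - (n + 1) = (z - ((2 * n + 1 : ℕ) + 1)) / 2 := by push_cast; ring
    have e2 : z / 2 + (n + 1) = (z + ((2 * n + 1 : ℕ) + 1)) / 2 := by push_cast; ring
    rw [e1, e2]; simp only [hf, one_div_div]; ring
  have hse : Summable fun n => f (2 * n) :=
    hfs.comp_injective (fun a b h => by simpa using h)
  have hso : Summable fun n => f (2 * n + 1) :=
    hfs.comp_injective (fun a b h => by simpa using h)
  have h3 := tsum_even_add_odd hse hso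
  have hE : ‖Complex.exp (-t)‖ < 1 := by
    rw [Complex.norm_exp]; simpa using ht
  rw [hodd, Complex.cot_eq_exp_ratio,
    show 2 * Complex.I * (π * (z / 2)) = -t by
      linear_combination Complex.I * hπz + t * Complex.I_mul_I] at h2
  rw [← h3, Complex.cot_eq_exp_ratio,
    show 2 * Complex.I * (π * z) = -t + -t by
      linear_combination 2 * Complex.I * hπz + 2 * t * Complex.I_mul_I, Complex.exp_add] at h1
  set E := Complex.exp (-t) with hEdef
  have hE1 : 1 - E ≠ 0 := fun h => by
    rw [← sub_eq_zero.1 h] at hE; simp at hE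
  have hE2 : 1 + E ≠ 0 := fun h => by
    rw [← neg_eq_of_add_eq_zero_right h] at hE; simp at hE
  have hE3 : 1 - E * E ≠ 0 := by
    rw [show 1 - E * E = (1 - E) * (1 + E) by ring]; exact mul_ne_zero hE1 hE2
  have hT : ∑' n : ℕ, f (2 * n) = π / (2 * Complex.I) * ((1 - E) / (1 + E)) := by
    have : ∑' n : ℕ, f (2 * n) = π * ((E * E + 1) / (Complex.I * (1 - E * E))) -
        π * ((E + 1) / (Complex.I * (1 - E))) / 2 := by
      linear_combination -h1 + h2 / 2
    rw [this, show 1 - E * E = (1 - E) * (1 + E) by ring]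
    field_simp
    ring
  have hfin := (hse.hasSum.mul_right (Complex.I / (2 * π * t)))
  rw [hT] at hfin
  rw [show π / (2 * Complex.I) * ((1 - E) / (1 + E)) * (Complex.I / (2 * π * t)) =
      (1 - E) / (1 + E) / (4 * t) by field_simp; norm_num] at hfin
  refine hfin.congr_fun fun n => ?_
  · have d1 : z - ((2 * n : ℕ) + 1) ≠ 0 := by
      have := Complex.integerComplement_add_ne_zero hzc (-((2 * n : ℕ) + 1))
      push_cast at this ⊢
      rwa [sub_eq_add_neg]
    have d2 : z + ((2 * n : ℕ) + 1) ≠ 0 := by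
      have := Complex.integerComplement_add_ne_zero hzc ((2 * n : ℕ) + 1)
      push_cast at this ⊢
      exact this
    have d3 : ((2 * n + 1) * π : ℂ) ^ 2 + (t : ℂ) ^ 2 =
        -π ^ 2 * ((z - ((2 * n : ℕ) + 1)) * (z + ((2 * n : ℕ) + 1))) := by
      push_cast
      linear_combination (π * z + t * Complex.I) * hπz + t ^ 2 * Complex.I_mul_I
    rw [d3, hf]
    dsimp only
    rw [div_add_div _ _ d1 d2, div_mul_div_comm, div_eq_div_iff]
    · linear_combination 2 * π * (z - ((2 * n : ℕ) + 1)) * (z + ((2 * n : ℕ) + 1)) *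
        (Complex.I * hπz + t * Complex.I_mul_I)
    · exact mul_ne_zero (neg_ne_zero.2 (pow_ne_zero 2 hπ)) (mul_ne_zero d1 d2)
    · exact mul_ne_zero (mul_ne_zero d1 d2) (mul_ne_zero (mul_ne_zero two_ne_zero hπ) ht')

lemma integral_exp_neg_mul_abs {a : ℝ} (ha : 0 < a) :
    ∫ w : ℝ, Real.exp (-(a * |w|)) = 2 / a := by
  rw [integral_comp_abs (f := fun x => Real.exp (-(a * x)))]
  have := integral_exp_mul_Ioi (a := -a) (by linarith) 0
  simp only [neg_mul] at this
  rw [this]; simp; ring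

lemma integrable_exp_neg_mul_abs {a : ℝ} (ha : 0 < a) :
    Integrable fun w : ℝ => Real.exp (-(a * |w|)) := by
  refine Integrable.of_integral_ne_zero ?_
  rw [integral_exp_neg_mul_abs ha]
  positivity

lemma integral_exp_neg_mul_abs_mul_exp {a : ℝ} (ha : 0 < a) (t : ℝ) :
    ∫ w : ℝ, Complex.exp (-(w * Complex.I * t)) * (Real.exp (-(a * |w|)) : ℝ) =
      2 * a / (a ^ 2 + t ^ 2) := by
  have hpos : ∀ w ∈ Ioi (0 : ℝ), Complex.exp (-(w * Complex.I * t)) * (Real.exp (-(a * |w|)) : ℝ)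
      = Complex.exp ((-a - t * Complex.I) * w) := by
    intro w hw
    rw [abs_of_pos hw, Complex.ofReal_exp, ← Complex.exp_add]
    congr 1; push_cast; ring
  have hneg : ∀ w ∈ Iic (0 : ℝ), Complex.exp (-(w * Complex.I * t)) * (Real.exp (-(a * |w|)) : ℝ)
      = Complex.exp ((a - t * Complex.I) * w) := by
    intro w hw
    rw [abs_of_nonpos hw, Complex.ofReal_exp, ← Complex.exp_add]
    congr 1; push_cast; ring
  have h1 : (-a - t * Complex.I : ℂ).re < 0 := by simpa using ha
  have h2 : 0 < (a - t * Complex.I : ℂ).re := by simpa using ha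
  rw [← intervalIntegral.integral_Iic_add_Ioi (b := 0)
    ((integrableOn_exp_mul_complex_Iic h2 0).congr_fun (fun w hw => (hneg w hw).symm)
      measurableSet_Iic)
    ((integrableOn_exp_mul_complex_Ioi h1 0).congr_fun (fun w hw => (hpos w hw).symm)
      measurableSet_Ioi),
    setIntegral_congr_fun measurableSet_Iic hneg, setIntegral_congr_fun measurableSet_Ioi hpos,
    integral_exp_mul_complex_Ioi h1, integral_exp_mul_complex_Iic h2]
  have n1 : (-a - t * Complex.I : ℂ) ≠ 0 := fun h => by simp [h] at h1
  have n2 : (a - t * Complex.I : ℂ) ≠ 0 := fun h => by simp [h] at h2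
  have n3 : (a ^ 2 + t ^ 2 : ℂ) ≠ 0 := by
    have : 0 < a ^ 2 + t ^ 2 := by positivity
    exact_mod_cast this.ne'
  simp
  field_simp
  ring_nf
  simp

lemma integrable_of_hasSum_of_summable_integral_norm {α : Type*} [MeasurableSpace α]
    {μ : Measure α} {F : ℕ → α → ℝ} {g : α → ℝ} (hF : ∀ i, Integrable (F i) μ)
    (hsum : Summable fun i => ∫ a, ‖F i a‖ ∂μ) (hg : ∀ᵐ a ∂μ, HasSum (F · a) (g a)) :
    Integrable g μ := by
  refine ⟨?_, ?_⟩
  · refine aestronglyMeasurable_of_tendsto_ae atTop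
      (f := fun n a => ∑ i ∈ Finset.range n, F i a) (fun n => ?_) ?_
    · exact (integrable_finsetSum _ fun i _ => hF i).aestronglyMeasurable
    · filter_upwards [hg] with a ha using ha.tendsto_sum_nat
  · calc ∫⁻ a, ‖g a‖ₑ ∂μ ≤ ∫⁻ a, ∑' i, ‖F i a‖ₑ ∂μ := by
          refine lintegral_mono_ae ?_
          filter_upwards [hg] with a ha
          rw [← ha.tsum_eq]
          exact enorm_tsum_le_tsum_enorm
      _ = ∑' i, ∫⁻ a, ‖F i a‖ₑ ∂μ :=
          lintegral_tsum fun i => (hF i).aestronglyMeasurable.enorm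
      _ = ∑' i, ENNReal.ofReal (∫ a, ‖F i a‖ ∂μ) := by
          simp_rw [ofReal_integral_norm_eq_lintegral_enorm (hF _)]
      _ < ⊤ := hsum.tsum_ofReal_lt_top

lemma hasSum_log_coth {x : ℝ} (hx : 0 < x) :
    HasSum (fun k : ℕ => 2 / (2 * k + 1 : ℝ) * Real.exp (-((2 * k + 1) * (2 * x))))
      (Real.log (Real.cosh x / Real.sinh x)) := by
  set q := Real.exp (-(2 * x)) with hq
  have hq0 : 0 < q := Real.exp_pos _
  have hq1 : q < 1 := by rw [hq, Real.exp_lt_one_iff]; linarith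
  have h := Real.hasSum_log_sub_log_of_abs_lt_one (x := q) (by rwa [abs_of_pos hq0])
  have hlog : Real.log (1 + q) - Real.log (1 - q) = Real.log (Real.cosh x / Real.sinh x) := by
    rw [← Real.log_div (by linarith) (by linarith)]
    congr 1
    have h1 : (1 - q) ≠ 0 := by linarith
    have hs : Real.sinh x ≠ 0 := (Real.sinh_pos_iff.2 hx).ne'
    rw [div_eq_div_iff h1 hs, Real.sinh_eq, Real.cosh_eq, hq,
      show -(2 * x) = -x + -x by ring, Real.exp_add]
    have := Real.exp_neg x
    have he := (Real.exp_pos x).ne'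
    rw [this]
    field_simp
  rw [hlog] at h
  refine h.congr_fun fun k => ?_
  rw [hq, ← Real.exp_nat_mul]
  push_cast
  rw [show (2 * (k : ℝ) + 1) * -(2 * x) = -((2 * k + 1) * (2 * x)) by ring]
  ring

/-- The density `(2 / π) * log (coth (π * |w| / 2))`. -/
noncomputable def logCothDensity (w : ℝ) : ℝ :=
  (2 / π) * Real.log (Real.cosh (π * |w| / 2) / Real.sinh (π * |w| / 2))

lemma measurable_logCothDensity : Measurable logCothDensity := by
  unfold logCothDensity
  have h : Continuous fun w : ℝ => π * |w| / 2 := by fun_prop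
  exact (((Real.continuous_cosh.comp h).measurable.div
    (Real.continuous_sinh.comp h).measurable).log).const_mul _

lemma hasSum_logCothDensity {w : ℝ} (hw : w ≠ 0) :
    HasSum (fun k : ℕ => 4 / π / (2 * k + 1) * Real.exp (-((2 * k + 1) * π * |w|)))
      (logCothDensity w) := by
  have h := (hasSum_log_coth (x := π * |w| / 2) (by positivity)).mul_left (2 / π)
  refine h.congr_fun fun k => ?_
  rw [show (2 * (k : ℝ) + 1) * (2 * (π * |w| / 2)) = (2 * k + 1) * π * |w| by ring]
  ring

lemma odd_mul_pi_sub_pos {c : ℝ} (hc : c ≤ 1) (k : ℕ) : 0 < (2 * k + 1) * π - c := by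
  have hπ := Real.pi_gt_three
  have : (0 : ℝ) ≤ k := k.cast_nonneg
  nlinarith

lemma summable_inv_odd_mul {c : ℝ} (hc : c ≤ 1) :
    Summable fun k : ℕ => 4 / π / (2 * k + 1) * (2 / ((2 * k + 1) * π - c)) := by
  have hs : Summable fun k : ℕ => 8 * (1 / ((k : ℝ) + 1) ^ 2) := by
    have := (summable_nat_add_iff (f := fun n : ℕ => 1 / (n : ℝ) ^ 2) 1).2
      (Real.summable_one_div_nat_pow.2 one_lt_two)
    push_cast at this
    exact this.mul_left 8
  have hπ := Real.pi_gt_three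
  have hd : ∀ k : ℕ, (k : ℝ) + 1 ≤ (2 * k + 1) * π - c := fun k => by
    have : (0 : ℝ) ≤ k := k.cast_nonneg
    nlinarith
  refine Summable.of_nonneg_of_le (fun k => ?_) (fun k => ?_) hs
  · have := odd_mul_pi_sub_pos hc k
    positivity
  · calc 4 / π / (2 * k + 1) * (2 / ((2 * k + 1) * π - c))
        ≤ 4 / 1 / (k + 1) * (2 / (k + 1)) := by
          have : (0 : ℝ) ≤ k := k.cast_nonneg
          have := odd_mul_pi_sub_pos hc k
          gcongr
          · linarith
          · linarith
          · exact hd k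
      _ = 8 * (1 / ((k : ℝ) + 1) ^ 2) := by field_simp; norm_num

lemma integrable_exp_abs_mul_logCothDensity :
    Integrable fun w : ℝ => Real.exp |w| * logCothDensity w := by
  refine integrable_of_hasSum_of_summable_integral_norm
    (F := fun k w => 4 / π / (2 * k + 1) * Real.exp (-(((2 * k + 1) * π - 1) * |w|)))
    (fun k => (integrable_exp_neg_mul_abs (odd_mul_pi_sub_pos le_rfl k)).const_mul _) ?_ ?_
  · refine (summable_inv_odd_mul le_rfl).congr fun k => ?_
    rw [← integral_exp_neg_mul_abs (odd_mul_pi_sub_pos le_rfl k), ← integral_const_mul]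
    congr 1 with w
    rw [Real.norm_of_nonneg (by positivity)]
  · filter_upwards [compl_mem_ae_iff.2 (measure_singleton (0 : ℝ))] with w hw
    refine ((hasSum_logCothDensity hw).mul_left (Real.exp |w|)).congr_fun fun k => ?_
    rw [mul_left_comm, ← Real.exp_add]
    ring_nf

lemma integrable_logCothDensity : Integrable logCothDensity := by
  refine integrable_exp_abs_mul_logCothDensity.mono
    measurable_logCothDensity.aestronglyMeasurable (Eventually.of_forall fun w => ?_)
  rw [norm_mul, Real.norm_of_nonneg (Real.exp_pos _).le]
  exact le_mul_of_one_le_left (norm_nonneg _) (Real.one_le_exp (abs_nonneg w))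

/-- The Laplace–Fourier transform of the density is `tanh (t / 2) / (t / 2)`. -/
lemma integral_exp_mul_logCothDensity {t : ℝ} (ht : 0 < t) :
    ∫ w : ℝ, Complex.exp (-(w * Complex.I * t)) * (logCothDensity w : ℂ) =
      2 * ((1 - Complex.exp (-t)) / (1 + Complex.exp (-t)) / t) := by
  have hpos : ∀ k : ℕ, 0 < (2 * k + 1) * π := fun k => by positivity
  have hnorm : ∀ w : ℝ, ‖Complex.exp (-(w * Complex.I * t))‖ = 1 := fun w => by
    rw [Complex.norm_exp]; simp
  have key := hasSum_integral_of_summable_integral_norm (μ := volume)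
    (F := fun (k : ℕ) (w : ℝ) => Complex.exp (-(w * Complex.I * t)) *
      ((4 / π / (2 * k + 1) * Real.exp (-((2 * k + 1) * π * |w|)) : ℝ) : ℂ)) (fun k => ?_) ?_
  · have e1 : ∫ w : ℝ, Complex.exp (-(w * Complex.I * t)) * (logCothDensity w : ℂ) =
        ∫ w : ℝ, ∑' k : ℕ, Complex.exp (-(w * Complex.I * t)) *
          ((4 / π / (2 * k + 1) * Real.exp (-((2 * k + 1) * π * |w|)) : ℝ) : ℂ) := by
      refine integral_congr_ae ?_
      filter_upwards [compl_mem_ae_iff.2 (measure_singleton (0 : ℝ))] with w hw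
      exact ((Complex.hasSum_ofReal.2 (hasSum_logCothDensity hw)).mul_left _).tsum_eq.symm
    rw [e1]
    refine key.unique ?_
    have h8 := (hasSum_inv_sq_add_odd_mul_pi_sq ht).mul_left 8
    rw [show (8 : ℂ) * ((1 - Complex.exp (-t)) / (1 + Complex.exp (-t)) / (4 * t)) =
      2 * ((1 - Complex.exp (-t)) / (1 + Complex.exp (-t)) / t) by ring] at h8
    refine h8.congr_fun fun k => ?_
    have e2 := integral_exp_neg_mul_abs_mul_exp (hpos k) t
    simp_rw [Complex.ofReal_mul _ (Real.exp _), mul_left_comm _ (Complex.ofReal (4 / π / _))]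
    rw [integral_const_mul, e2]
    push_cast
    have n1 : (2 * k + 1 : ℂ) ≠ 0 := by exact_mod_cast (by omega : 2 * k + 1 ≠ 0)
    have n2 : (π : ℂ) ≠ 0 := by exact_mod_cast pi_ne_zero
    field_simp
    norm_num
  · refine ((integrable_exp_neg_mul_abs (hpos k)).const_mul _).ofReal.bdd_mul (c := 1)
      (by fun_prop) (Eventually.of_forall fun w => (hnorm w).le)
  · refine (summable_inv_odd_mul zero_le_one).congr fun k => ?_
    rw [sub_zero, ← integral_exp_neg_mul_abs (hpos k), ← integral_const_mul]
    congr 1 with w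
    rw [norm_mul, hnorm, one_mul, Complex.norm_real, Real.norm_of_nonneg (by positivity)]

lemma exists_exp_mul_norm_log_le {b : ℝ} (hb : 0 < b) (M : ℕ) :
    ∃ C : ℝ, ∀ w : ℝ,
      Real.exp (M * ‖Complex.log (b + w * Complex.I)‖) ≤ C * Real.exp |w| := by
  refine ⟨Real.exp (M * π) * (M.factorial * Real.exp b + (b⁻¹) ^ M), fun w => ?_⟩
  set z : ℂ := b + w * Complex.I with hz
  have hzb : b ≤ ‖z‖ := by
    have := Complex.re_le_norm z
    simpa [hz] using this
  have hzu : ‖z‖ ≤ b + |w| := by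
    refine (norm_add_le _ _).trans ?_
    simp [abs_of_pos hb]
  have hz0 : 0 < ‖z‖ := hb.trans_le hzb
  have hL : ‖Complex.log z‖ ≤ |Real.log ‖z‖| + π := by
    refine (Complex.norm_le_abs_re_add_abs_im _).trans ?_
    rw [Complex.log_re, Complex.log_im]
    gcongr
    exact Complex.abs_arg_le_pi z
  have hw1 : 1 ≤ Real.exp |w| := Real.one_le_exp (abs_nonneg w)
  have h1 : ‖z‖ ^ M ≤ M.factorial * Real.exp b * Real.exp |w| := by
    have := Real.pow_div_factorial_le_exp (x := b + |w|) (by positivity) M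
    rw [div_le_iff₀ (by positivity), Real.exp_add] at this
    calc ‖z‖ ^ M ≤ (b + |w|) ^ M := by gcongr
      _ ≤ _ := this
      _ = _ := by ring
  have h2 : (‖z‖⁻¹) ^ M ≤ (b⁻¹) ^ M * Real.exp |w| := by
    calc (‖z‖⁻¹) ^ M ≤ (b⁻¹) ^ M := by gcongr
      _ ≤ _ := le_mul_of_one_le_right (by positivity) hw1
  have h3 : Real.exp (M * |Real.log ‖z‖|) ≤ ‖z‖ ^ M + (‖z‖⁻¹) ^ M := by
    rw [Real.exp_nat_mul]
    rcases abs_cases (Real.log ‖z‖) with ⟨h, _⟩ | ⟨h, _⟩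
    · rw [h, Real.exp_log hz0]
      exact le_add_of_nonneg_right (by positivity)
    · rw [h, Real.exp_neg, Real.exp_log hz0]
      exact le_add_of_nonneg_left (by positivity)
  calc Real.exp (M * ‖Complex.log z‖) ≤ Real.exp (M * (|Real.log ‖z‖| + π)) := by gcongr
    _ = Real.exp (M * π) * Real.exp (M * |Real.log ‖z‖|) := by
      rw [← Real.exp_add]; ring_nf
    _ ≤ Real.exp (M * π) * (M.factorial * Real.exp b * Real.exp |w| +
          (b⁻¹) ^ M * Real.exp |w|) := by
      gcongr
      exact h3.trans (add_le_add h1 h2)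
    _ = _ := by ring

lemma differentiable_integral_cpow_neg_mul {b : ℝ} (hb : 0 < b) {g : ℝ → ℝ}
    (hg : Measurable g) (hi : Integrable fun w => Real.exp |w| * g w) :
    Differentiable ℂ fun s : ℂ => ∫ w : ℝ, ((b : ℂ) + w * Complex.I) ^ (-s) * (g w : ℂ) := by
  intro s₀
  obtain ⟨N, hN⟩ := exists_nat_ge (‖s₀‖ + 1)
  obtain ⟨C, hC⟩ := exists_exp_mul_norm_log_le hb (N + 1)
  have hz0 : ∀ w : ℝ, (b : ℂ) + w * Complex.I ≠ 0 := fun w h => by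
    simpa [hb.ne'] using congrArg Complex.re h
  have hm : ∀ s : ℂ, AEStronglyMeasurable
      (fun w : ℝ => ((b : ℂ) + w * Complex.I) ^ (-s) * (g w : ℂ)) := fun s =>
    Measurable.aestronglyMeasurable (by fun_prop)
  have hcpow : ∀ s ∈ Metric.ball s₀ 1, ∀ w : ℝ, ‖((b : ℂ) + w * Complex.I) ^ (-s)‖ ≤
      Real.exp (N * ‖Complex.log (b + w * Complex.I)‖) := by
    intro s hs w
    have hs' : ‖s‖ ≤ N := by
      have h1 := norm_sub_norm_le s s₀
      rw [mem_ball_iff_norm] at hs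
      linarith
    rw [Complex.cpow_def_of_ne_zero (hz0 w)]
    refine (Complex.norm_exp_le_exp_norm _).trans (Real.exp_le_exp.2 ?_)
    rw [norm_mul, norm_neg, mul_comm]
    gcongr
  have hle : ∀ w : ℝ, Real.exp (N * ‖Complex.log (b + w * Complex.I)‖) ≤
      Real.exp ((N + 1 : ℕ) * ‖Complex.log (b + w * Complex.I)‖) := fun w => by
    gcongr
    simp
  have hb1 : Integrable fun w => ‖C * (Real.exp |w| * g w)‖ := (hi.const_mul C).norm
  have hbound : ∀ w : ℝ, Real.exp ((N + 1 : ℕ) * ‖Complex.log (b + w * Complex.I)‖) * ‖(g w : ℂ)‖ ≤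
      ‖C * (Real.exp |w| * g w)‖ := fun w => by
    rw [← mul_assoc, norm_mul, Complex.norm_real]
    gcongr
    exact (hC w).trans (le_abs_self _)
  refine (hasDerivAt_integral_of_dominated_loc_of_deriv_le (x₀ := s₀)
    (F := fun (s : ℂ) (w : ℝ) => ((b : ℂ) + w * Complex.I) ^ (-s) * (g w : ℂ))
    (F' := fun s w => ((b : ℂ) + w * Complex.I) ^ (-s) * Complex.log (b + w * Complex.I) * (-1) *
      (g w : ℂ)) (Metric.ball_mem_nhds s₀ one_pos) (Eventually.of_forall hm) ?_ ?_ ?_ hb1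
    ?_).2.differentiableAt
  · refine hb1.mono' (hm s₀) (Eventually.of_forall fun w => ?_)
    rw [norm_mul]
    refine le_trans ?_ (hbound w)
    gcongr
    exact (hcpow s₀ (Metric.mem_ball_self one_pos) w).trans (hle w)
  · exact Measurable.aestronglyMeasurable (by fun_prop)
  · refine Eventually.of_forall fun w s hs => ?_
    refine le_trans ?_ (hbound w)
    rw [norm_mul, norm_mul, norm_mul, norm_neg, norm_one, mul_one]
    gcongr
    have hexp : ‖Complex.log (b + w * Complex.I)‖ ≤
        Real.exp ‖Complex.log (b + w * Complex.I)‖ :=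
      (le_add_of_nonneg_right zero_le_one).trans (Real.add_one_le_exp _)
    rw [show ((N + 1 : ℕ) : ℝ) * ‖Complex.log (b + w * Complex.I)‖ =
      N * ‖Complex.log (b + w * Complex.I)‖ + ‖Complex.log (b + w * Complex.I)‖ by
        push_cast; ring, Real.exp_add]
    gcongr
    exact hcpow s hs w
  · refine Eventually.of_forall fun w s _ => ?_
    exact ((hasDerivAt_neg s).const_cpow (Or.inl (hz0 w))).mul_const _

lemma integral_Ioo_exp_neg_mul {t : ℝ} (ht : 0 < t) :
    ∫ u in Ioo (0 : ℝ) 1, Complex.exp (-(u * t)) = (1 - Complex.exp (-t)) / t := by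
  have ht' : (t : ℂ) ≠ 0 := by exact_mod_cast ht.ne'
  rw [← integral_Ioc_eq_integral_Ioo, ← intervalIntegral.integral_of_le zero_le_one]
  have h := integral_exp_mul_complex (a := 0) (b := 1) (neg_ne_zero.2 ht')
  rw [show (fun u : ℝ => Complex.exp (-(u * t))) = fun u : ℝ => Complex.exp (-t * u) by
    ext u; ring_nf]
  rw [h]
  simp only [Complex.ofReal_one, mul_one, Complex.ofReal_zero, mul_zero, Complex.exp_zero]
  rw [div_neg, ← neg_div, neg_sub]

lemma norm_one_sub_exp_neg_div_le {t : ℝ} (ht : 0 < t) :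
    ‖(1 - Complex.exp (-t)) / t‖ ≤ 1 := by
  have h1 : Real.exp (-t) ≤ 1 := Real.exp_le_one_iff.2 (by linarith)
  have h2 := Real.add_one_le_exp (-t)
  rw [show (1 - Complex.exp (-t)) / t = (((1 - Real.exp (-t)) / t : ℝ) : ℂ) by push_cast; rfl,
    Complex.norm_real, Real.norm_of_nonneg (div_nonneg (by linarith) ht.le), div_le_one ht]
  linarith

lemma gamma_mul_integral_Ioo_cpow {c : ℝ} (hc : 0 < c) {s : ℂ} (hs : 0 < s.re) :
    Complex.Gamma s * ∫ u in Ioo (0 : ℝ) 1, ((c : ℂ) + u) ^ (-s) =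
      ∫ t in Ioi (0 : ℝ), (t : ℂ) ^ (s - 1) * Complex.exp (-(c * t)) *
        ((1 - Complex.exp (-t)) / t) := by
  have h := gamma_mul_integral_cpow (μ := volume.restrict (Ioo (0 : ℝ) 1)) (g := fun _ => 1)
    (θ := fun u : ℝ => (u : ℂ)) (integrable_const 1) (by fun_prop) (by
      filter_upwards [ae_restrict_mem measurableSet_Ioo] with u hu
      simpa using hu.1.le) hc hs
  simp only [mul_one] at h
  rw [h]
  refine setIntegral_congr_fun measurableSet_Ioi fun t ht => ?_
  rw [integral_Ioo_exp_neg_mul ht]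

lemma gamma_mul_tsum_integral_Ioo_cpow {b : ℝ} (hb : 0 < b) {s : ℂ} (hs : 1 < s.re) :
    Complex.Gamma s *
        ∑' n : ℕ, ∫ u in Ioo (0 : ℝ) 1, (-1 : ℂ) ^ n * (((n : ℂ) + b + u) ^ (-s)) =
      ∫ t in Ioi (0 : ℝ), (t : ℂ) ^ (s - 1) * Complex.exp (-(b * t)) *
        ((1 - Complex.exp (-t)) / (1 + Complex.exp (-t)) / t) := by
  have hs0 : 0 < s.re := zero_lt_one.trans hs
  have hc : ∀ n : ℕ, 0 < (n : ℝ) + b := fun n => by positivity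
  set G : ℕ → ℝ → ℂ := fun n t => (-1) ^ n * ((t : ℂ) ^ (s - 1) *
    Complex.exp (-(((n + b : ℝ) : ℂ) * t)) * ((1 - Complex.exp (-t)) / t)) with hG
  have hterm : ∀ n : ℕ,
      Complex.Gamma s * ∫ u in Ioo (0 : ℝ) 1, (-1 : ℂ) ^ n * (((n : ℂ) + b + u) ^ (-s)) =
        ∫ t in Ioi (0 : ℝ), G n t := fun n => by
    rw [integral_const_mul, integral_const_mul, ← gamma_mul_integral_Ioo_cpow (hc n) hs0]
    push_cast
    ring
  have hbase : ∀ n : ℕ, IntegrableOn (fun t : ℝ => (t : ℂ) ^ (s - 1) *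
      Complex.exp (-(((n + b : ℝ) : ℂ) * t))) (Ioi 0) := fun n =>
    integrableOn_cpow_mul_exp_neg_mul hs0 (by simpa using hc n)
  have hle : ∀ n : ℕ, ∀ t ∈ Ioi (0 : ℝ), ‖G n t‖ ≤
      t ^ (s.re - 1) * Real.exp (-((n + b) * t)) := fun n t ht => by
    have : ‖(t : ℂ) ^ (s - 1) * Complex.exp (-(((n + b : ℝ) : ℂ) * t))‖ =
        t ^ (s.re - 1) * Real.exp (-((n + b) * t)) := by
      rw [norm_mul, Complex.norm_cpow_eq_rpow_re_of_pos ht, Complex.norm_exp]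
      simp
    rw [hG, ← this, norm_mul, norm_pow, norm_neg, norm_one, one_pow, one_mul, norm_mul]
    exact mul_le_of_le_one_right (norm_nonneg _) (norm_one_sub_exp_neg_div_le ht)
  have hint : ∀ n : ℕ, IntegrableOn (G n) (Ioi 0) := fun n => by
    refine ((hbase n).mul_bdd (c := 1) (g := fun t : ℝ => (1 - Complex.exp (-t)) / (t : ℂ))
      (Measurable.aestronglyMeasurable (by fun_prop)) ?_).const_mul _
    filter_upwards [ae_restrict_mem measurableSet_Ioi] with t ht
    exact norm_one_sub_exp_neg_div_le ht
  have hreal : ∀ n : ℕ, IntegrableOn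
      (fun t : ℝ => t ^ (s.re - 1) * Real.exp (-((n + b) * t))) (Ioi 0) := fun n => by
    simpa only [Real.rpow_one, neg_mul] using integrableOn_rpow_mul_exp_neg_mul_rpow (p := 1) (s := s.re - 1) (b := n + b)
      (by linarith) one_pos (hc n)
  have hsum : Summable fun n => ∫ t in Ioi (0 : ℝ), ‖G n t‖ := by
    have h1 := ((Real.summable_one_div_nat_add_rpow b s.re).2 hs).mul_right (Real.Gamma s.re)
    refine Summable.of_nonneg_of_le (fun n => integral_nonneg fun t => norm_nonneg _)
      (fun n => ?_) h1
    refine (setIntegral_mono_on (hint n).norm (hreal n) measurableSet_Ioi (hle n)).trans_eq ?_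
    rw [Real.integral_rpow_mul_exp_neg_mul_Ioi hs0 (hc n), abs_of_pos (hc n),
      Real.div_rpow zero_le_one (hc n).le, Real.one_rpow]
  have key := hasSum_integral_of_summable_integral_norm hint hsum
  rw [← tsum_mul_left, tsum_congr hterm, key.tsum_eq]
  refine setIntegral_congr_fun measurableSet_Ioi fun t ht => ?_
  have ht' : 0 < t := ht
  have hE : ‖-Complex.exp (-t)‖ < 1 := by
    rw [norm_neg, Complex.norm_exp]; simpa using ht'
  have hgeo := (hasSum_geometric_of_norm_lt_one hE).mul_left
    ((t : ℂ) ^ (s - 1) * Complex.exp (-(b * t)) * ((1 - Complex.exp (-t)) / t))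
  have hGsum : HasSum (fun n => G n t) _ := hgeo.congr_fun fun n => by
    rw [hG, neg_pow, ← Complex.exp_nat_mul]
    dsimp only
    push_cast
    rw [show -((n + b : ℂ) * t) = -(b * t) + n * (-t) by ring, Complex.exp_add]
    ring
  rw [hGsum.tsum_eq, sub_neg_eq_add]
  ring

lemma tsum_integral_Ioo_cpow_eq {b : ℝ} (hb : 0 < b) {s : ℂ} (hs : 1 < s.re) :
    ∑' n : ℕ, ∫ u in Ioo (0 : ℝ) 1, (-1 : ℂ) ^ n * (((n : ℂ) + b + u) ^ (-s)) =
      (1 / 2) * ∫ w : ℝ, ((b : ℂ) + w * Complex.I) ^ (-s) * (logCothDensity w : ℂ) := by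
  have hs0 : 0 < s.re := zero_lt_one.trans hs
  have hg : Integrable fun w => (logCothDensity w : ℂ) := integrable_logCothDensity.ofReal
  refine mul_left_cancel₀ (Complex.Gamma_ne_zero_of_re_pos hs0) ?_
  rw [gamma_mul_tsum_integral_Ioo_cpow hb hs, mul_left_comm,
    gamma_mul_integral_cpow (θ := fun w : ℝ => w * Complex.I) hg (by fun_prop)
      (by simp) hb hs0, ← integral_const_mul]
  refine setIntegral_congr_fun measurableSet_Ioi fun t ht => ?_
  rw [integral_exp_mul_logCothDensity ht]
  ring

end

/-- Integral representation of ζ_T(s;b) = ∑ₙ E[(-1)^n (n+b+U)^{-s}] (U uniform on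
(0,1)) through the density h(w) = (2/π) log coth(π|w|/2), and its entire extension. -/
theorem tanh_zeta_integral_repr (b : ℝ) (hb : 0 < b)
    (h : ℝ → ℝ)
    (hh : ∀ w, h w = (2 / π) * Real.log (Real.cosh (π * |w| / 2) / Real.sinh (π * |w| / 2))) :
    (∀ s : ℂ, 1 < s.re →
      ∑' n : ℕ, ∫ u in Set.Ioo (0 : ℝ) 1, (-1 : ℂ) ^ n * (((n : ℂ) + b + u) ^ (-s))
        = (1 / 2) * ∫ w : ℝ, ((b : ℂ) + w * Complex.I) ^ (-s) * (h w : ℝ)) ∧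
    ∃ F : ℂ → ℂ, Differentiable ℂ F ∧
      ∀ s : ℂ, 1 < s.re →
        F s = ∑' n : ℕ, ∫ u in Set.Ioo (0 : ℝ) 1, (-1 : ℂ) ^ n * (((n : ℂ) + b + u) ^ (-s)) := by
  obtain rfl : h = logCothDensity := funext hh
  refine ⟨fun s hs => tsum_integral_Ioo_cpow_eq hb hs, fun s => (1 / 2) *
    ∫ w : ℝ, ((b : ℂ) + w * Complex.I) ^ (-s) * (logCothDensity w : ℂ), ?_, fun s hs =>
      (tsum_integral_Ioo_cpow_eq hb hs).symm⟩
  exact (differentiable_integral_cpow_neg_mul hb measurable_logCothDensity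
    integrable_exp_abs_mul_logCothDensity).const_mul _
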